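/- Let S be an N×N real symmetric positive definite matrix and J̃ an N×N real antisymmetric matrix, and set B̃ = S + J̃. Then the following are equivalent: (i) B̃ is diagonalizable over ℂ and every eigenvalue λ ∈ ℂ of B̃ satisfies Re(λ) = Tr(S)/N; (ii) there exists an invertible complex matrix P such that P⁻¹·(B̃ − (Tr(S)/N)·I)·P is skew-Hermitian (its conjugate transpose equals its negative); (iii) there exists a Hermitian positive definite complex matrix Q with J̃Q − QJ̃ = −QS − SQ + (2·Tr(S)/N)·Q; (iv) there exists a real symmetric positive definite matrix Q with J̃Q − QJ̃ = −QS − SQ + (2·Tr(S)/N)·Q. -/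

import Mathlib

open Matrix

/-- A complex matrix is Hermitian positive definite. -/
def CPosDef {N : ℕ} (Q : Matrix (Fin N) (Fin N) ℂ) : Prop :=
  Q.IsHermitian ∧ ∀ x : Fin N → ℂ, x ≠ 0 → 0 < (star x ⬝ᵥ (Q *ᵥ x)).re

section

open scoped ComplexOrder

variable {n : Type*} [Fintype n] [DecidableEq n]

lemma exists_eq_conj_diagonal_of_skewHermitian {K : Matrix n n ℂ} (hK : Kᴴ = -K) :
    ∃ (U : Matrix n n ℂ) (e : n → ℝ), IsUnit U ∧
      K = U * diagonal (fun i => -(Complex.I * e i)) * U⁻¹ := by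
  have hH : (Complex.I • K).IsHermitian := by
    simp [IsHermitian, conjTranspose_smul, hK]
  refine ⟨hH.eigenvectorUnitary, hH.eigenvalues,
    ⟨Unitary.toUnits hH.eigenvectorUnitary, rfl⟩, ?_⟩
  have hinv : (hH.eigenvectorUnitary : Matrix n n ℂ)⁻¹ =
      star (hH.eigenvectorUnitary : Matrix n n ℂ) :=
    inv_eq_left_inv (Unitary.coe_star_mul_self _)
  have hspec := hH.spectral_theorem
  rw [Unitary.conjStarAlgAut_apply] at hspec
  have hdiag : diagonal (fun i => -(Complex.I * (hH.eigenvalues i : ℂ))) =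
      (-Complex.I) • diagonal (RCLike.ofReal ∘ hH.eigenvalues : n → ℂ) := by
    rw [← diagonal_smul]
    congr 1
    ext i
    simp
  rw [hinv, hdiag, mul_smul_comm, smul_mul_assoc, ← hspec, smul_smul]
  simp

lemma spectrum_conj_diagonal {P : Matrix n n ℂ} (hP : IsUnit P) (d : n → ℂ) :
    spectrum ℂ (P * diagonal d * P⁻¹) = Set.range d := by
  obtain ⟨u, rfl⟩ := hP
  rw [← coe_units_inv, spectrum.units_conjugate, spectrum_diagonal]

lemma diagonalizable_re_eq_iff_similar_skewHermitian (A : Matrix n n ℂ) (c : ℝ) :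
    ((∃ (P : Matrix n n ℂ) (d : n → ℂ), IsUnit P ∧ A = P * diagonal d * P⁻¹) ∧
        ∀ μ ∈ spectrum ℂ A, μ.re = c) ↔
      ∃ P : Matrix n n ℂ, IsUnit P ∧
        (P⁻¹ * (A - (c : ℂ) • 1) * P)ᴴ = -(P⁻¹ * (A - (c : ℂ) • 1) * P) := by
  constructor
  · rintro ⟨⟨P, d, hP, rfl⟩, hre⟩
    refine ⟨P, hP, ?_⟩
    rw [spectrum_conj_diagonal hP, Set.forall_mem_range] at hre
    have hdet := (isUnit_iff_isUnit_det P).1 hP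
    have hconj : P⁻¹ * (P * diagonal d * P⁻¹ - (c : ℂ) • 1) * P =
        diagonal (fun i => d i - c) := by
      rw [mul_sub, sub_mul, mul_smul_comm, smul_mul_assoc, mul_one, nonsing_inv_mul _ hdet,
        mul_assoc, nonsing_inv_mul_cancel_right _ _ hdet, nonsing_inv_mul_cancel_left _ _ hdet,
        smul_one_eq_diagonal, diagonal_sub]
    rw [hconj, diagonal_conjTranspose, diagonal_neg]
    congr 1
    ext i
    apply Complex.ext <;> simp [hre i]
  · rintro ⟨P, hP, hskew⟩
    obtain ⟨U, e, hU, hK⟩ := exists_eq_conj_diagonal_of_skewHermitian hskew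
    have hdet := (isUnit_iff_isUnit_det P).1 hP
    have hPU : IsUnit (P * U) := hP.mul hU
    have hdetPU := (isUnit_iff_isUnit_det _).1 hPU
    have hA : A = P * U * diagonal (fun i => (c : ℂ) - Complex.I * e i) * (P * U)⁻¹ := by
      have hsplit : diagonal (fun i => (c : ℂ) - Complex.I * e i) =
          (c : ℂ) • 1 + diagonal (fun i => -(Complex.I * (e i : ℂ))) := by
        rw [smul_one_eq_diagonal, diagonal_add]
        simp [sub_eq_add_neg]
      have hsub : A - (c : ℂ) • 1 =
          P * U * diagonal (fun i => -(Complex.I * (e i : ℂ))) * (P * U)⁻¹ := by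
        calc A - (c : ℂ) • 1 = P * (P⁻¹ * (A - (c : ℂ) • 1) * P) * P⁻¹ := by
              rw [mul_assoc P⁻¹, mul_nonsing_inv_cancel_left _ _ hdet,
                mul_nonsing_inv_cancel_right _ _ hdet]
          _ = _ := by rw [hK, Matrix.mul_inv_rev]; simp only [mul_assoc]
      rw [hsplit, mul_add, add_mul, ← hsub, mul_smul_comm, smul_mul_assoc, mul_one,
        mul_nonsing_inv _ hdetPU]
      abel
    refine ⟨⟨P * U, _, hPU, hA⟩, ?_⟩
    rw [hA, spectrum_conj_diagonal hPU, Set.forall_mem_range]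
    intro i
    simp

lemma similar_skewHermitian_iff_exists_posDef_lyapunov (A : Matrix n n ℂ) :
    (∃ P : Matrix n n ℂ, IsUnit P ∧ (P⁻¹ * A * P)ᴴ = -(P⁻¹ * A * P)) ↔
      ∃ Q : Matrix n n ℂ, Q.PosDef ∧ A * Q + Q * Aᴴ = 0 := by
  have key : ∀ P : Matrix n n ℂ, IsUnit P →
      A * (P * Pᴴ) + P * Pᴴ * Aᴴ = P * (P⁻¹ * A * P + (P⁻¹ * A * P)ᴴ) * Pᴴ := by
    intro P hP
    have hAP : A * P = P * (P⁻¹ * A * P) := by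
      rw [mul_assoc P⁻¹, mul_nonsing_inv_cancel_left _ _ ((isUnit_iff_isUnit_det P).1 hP)]
    have hAP' := congrArg conjTranspose hAP
    rw [conjTranspose_mul, conjTranspose_mul P] at hAP'
    rw [mul_assoc P, hAP', ← mul_assoc A, hAP]
    simp only [mul_add, add_mul, mul_assoc]
  constructor
  · rintro ⟨P, hP, hskew⟩
    refine ⟨P * Pᴴ, .mul_conjTranspose_self P (vecMul_injective_of_isUnit hP), ?_⟩
    rw [key P hP, hskew]
    simp
  · rintro ⟨Q, hQ, hlyap⟩
    open scoped MatrixOrder Matrix.Norms.L2Operator in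
    obtain ⟨P, hP, rfl⟩ := CStarAlgebra.isStrictlyPositive_iff_eq_mul_star_self.mp
      hQ.isStrictlyPositive
    refine ⟨P, hP, ?_⟩
    rw [star_eq_conjTranspose, key P hP] at hlyap
    have hPH : IsUnit Pᴴ := hP.star
    rw [hPH.mul_left_eq_zero, hP.mul_right_eq_zero] at hlyap
    exact eq_neg_of_add_eq_zero_right hlyap

lemma Matrix.PosDef.map_re {m : Type*} [Fintype m] {Q : Matrix m m ℂ} (hQ : Q.PosDef) :
    (Q.map Complex.re).PosDef := by
  refine .of_dotProduct_mulVec_pos ?_ fun x hx => ?_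
  · ext i j
    simpa using congrArg Complex.re (hQ.isHermitian.apply i j)
  · have hx' : (fun i => (x i : ℂ)) ≠ 0 := fun h => hx <| funext fun i => by
      simpa using congrFun h i
    have h := hQ.re_dotProduct_pos hx'
    simpa [dotProduct, mulVec] using h

lemma Matrix.PosDef.map_ofReal {Q : Matrix n n ℝ} (hQ : Q.PosDef) :
    (Q.map Complex.ofReal).PosDef := by
  open scoped MatrixOrder Matrix.Norms.L2Operator in
  obtain ⟨P, hP, rfl⟩ := CStarAlgebra.isStrictlyPositive_iff_eq_mul_star_self.mp
    hQ.isStrictlyPositive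
  have hP' : IsUnit (P.map Complex.ofReal) := hP.map Complex.ofRealHom.mapMatrix
  have hmap : (P * star P).map Complex.ofReal =
      P.map Complex.ofReal * (P.map Complex.ofReal)ᴴ := by
    ext i j
    simp [mul_apply]
  rw [hmap]
  exact .mul_conjTranspose_self _ (vecMul_injective_of_isUnit hP')

lemma exists_complex_posDef_lyapunov_iff_real (A : Matrix n n ℝ) :
    (∃ Q : Matrix n n ℂ, Q.PosDef ∧
        A.map Complex.ofReal * Q + Q * (A.map Complex.ofReal)ᴴ = 0) ↔
      ∃ Q : Matrix n n ℝ, Q.PosDef ∧ A * Q + Q * Aᵀ = 0 := by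
  constructor
  · rintro ⟨Q, hQ, h⟩
    refine ⟨Q.map Complex.re, hQ.map_re, ?_⟩
    ext i j
    simpa [mul_apply] using congrArg Complex.re (congrFun₂ h i j)
  · rintro ⟨Q, hQ, h⟩
    refine ⟨Q.map Complex.ofReal, hQ.map_ofReal, ?_⟩
    ext i j
    simpa [mul_apply] using congrArg Complex.ofReal (congrFun₂ h i j)

lemma commutator_eq_iff_lyapunov {R : Type*} [CommRing R] {S J : Matrix n n R}
    (hS : Sᵀ = S) (hJ : Jᵀ = -J) (c : R) (Q : Matrix n n R) :
    J * Q - Q * J = -(Q * S) - S * Q + (2 * c) • Q ↔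
      (S + J - c • 1) * Q + Q * (S + J - c • 1)ᵀ = 0 := by
  rw [← sub_eq_zero]
  simp only [transpose_sub, transpose_add, transpose_smul, transpose_one, hS, hJ, mul_add,
    add_mul, mul_sub, sub_mul, mul_smul_comm, smul_mul_assoc, mul_one, one_mul, mul_neg, two_mul,
    add_smul]
  refine Eq.congr_left ?_
  abel

lemma cPosDef_iff_posDef {N : ℕ} (Q : Matrix (Fin N) (Fin N) ℂ) : CPosDef Q ↔ Q.PosDef := by
  refine ⟨fun h => .of_dotProduct_mulVec_pos h.1 fun x hx => ?_,
    fun h => ⟨h.isHermitian, fun x hx => h.re_dotProduct_pos hx⟩⟩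
  exact RCLike.pos_iff.2 ⟨h.2 x hx, h.1.im_star_dotProduct_mulVec_self x⟩

end

/-- For `S` symmetric positive definite and `J̃` antisymmetric,
`B̃ = S + J̃`, the following are equivalent:
(i) `B̃` is diagonalizable over `ℂ` and all its eigenvalues have real part `Tr(S)/N`;
(ii) `B̃ - (Tr(S)/N)·I` is similar (over `ℂ`) to a skew-Hermitian matrix;
(iii) there is a Hermitian positive definite complex `Q` with
`J̃Q - QJ̃ = -QS - SQ + (2Tr(S)/N)Q`;
(iv) there is a real symmetric positive definite `Q` with the same equation. -/
theorem optimal_perturbation_characterization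
    (N : ℕ) (hN : 1 ≤ N) (S J : Matrix (Fin N) (Fin N) ℝ)
    (hS : S.PosDef) (hJ : Jᵀ = -J) :
    (((∃ (P : Matrix (Fin N) (Fin N) ℂ) (d : Fin N → ℂ), IsUnit P ∧
          (S + J).map (Complex.ofReal) = P * Matrix.diagonal d * P⁻¹) ∧
        (∀ μ ∈ spectrum ℂ ((S + J).map (Complex.ofReal)), μ.re = S.trace / N)) ↔
      (∃ P : Matrix (Fin N) (Fin N) ℂ, IsUnit P ∧
        (P⁻¹ * ((S + J).map (Complex.ofReal) - ((S.trace / N : ℝ) : ℂ) • 1) * P)ᴴ =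
          -(P⁻¹ * ((S + J).map (Complex.ofReal) - ((S.trace / N : ℝ) : ℂ) • 1) * P))) ∧
    ((∃ P : Matrix (Fin N) (Fin N) ℂ, IsUnit P ∧
        (P⁻¹ * ((S + J).map (Complex.ofReal) - ((S.trace / N : ℝ) : ℂ) • 1) * P)ᴴ =
          -(P⁻¹ * ((S + J).map (Complex.ofReal) - ((S.trace / N : ℝ) : ℂ) • 1) * P)) ↔
      (∃ Q : Matrix (Fin N) (Fin N) ℂ, CPosDef Q ∧
        J.map (Complex.ofReal) * Q - Q * J.map (Complex.ofReal) =
          -(Q * S.map (Complex.ofReal)) - S.map (Complex.ofReal) * Q +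
            ((2 * S.trace / N : ℝ) : ℂ) • Q)) ∧
    ((∃ Q : Matrix (Fin N) (Fin N) ℂ, CPosDef Q ∧
        J.map (Complex.ofReal) * Q - Q * J.map (Complex.ofReal) =
          -(Q * S.map (Complex.ofReal)) - S.map (Complex.ofReal) * Q +
            ((2 * S.trace / N : ℝ) : ℂ) • Q) ↔
      (∃ Q : Matrix (Fin N) (Fin N) ℝ, Q.PosDef ∧
        J * Q - Q * J = -(Q * S) - S * Q + (2 * S.trace / N) • Q)) := by
  have hST : Sᵀ = S := by simpa using hS.isHermitian.eq
  set c : ℝ := S.trace / N with hc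
  have h2c : 2 * S.trace / N = 2 * c := by rw [hc, mul_div_assoc]
  have hmap : (S + J).map Complex.ofReal - (c : ℂ) • 1 =
      (S + J - c • 1).map Complex.ofReal := by
    ext i j
    by_cases hij : i = j <;> simp [hij]
  have hcomplex : ∀ Q : Matrix (Fin N) (Fin N) ℂ,
      J.map Complex.ofReal * Q - Q * J.map Complex.ofReal =
        -(Q * S.map Complex.ofReal) - S.map Complex.ofReal * Q + ((2 * c : ℝ) : ℂ) • Q ↔
      (S + J - c • 1).map Complex.ofReal * Q +
        Q * ((S + J - c • 1).map Complex.ofReal)ᴴ = 0 := by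
    intro Q
    have hS' : (S.map Complex.ofReal)ᵀ = S.map Complex.ofReal := by rw [← transpose_map, hST]
    have hJ' : (J.map Complex.ofReal)ᵀ = -J.map Complex.ofReal := by
      rw [← transpose_map, hJ]
      ext i j
      simp
    have hH : ((S + J - c • 1).map Complex.ofReal)ᴴ =
        ((S + J - c • 1).map Complex.ofReal)ᵀ := by
      ext i j
      exact Complex.conj_ofReal _
    have hadd : (S + J).map Complex.ofReal = S.map Complex.ofReal + J.map Complex.ofReal := by
      ext i j
      simp
    rw [Complex.ofReal_mul, Complex.ofReal_ofNat, commutator_eq_iff_lyapunov hS' hJ', hH, ← hmap,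
      hadd]
  refine ⟨diagonalizable_re_eq_iff_similar_skewHermitian _ _, ?_, ?_⟩
  · simp only [h2c, hcomplex, cPosDef_iff_posDef, hmap]
    exact similar_skewHermitian_iff_exists_posDef_lyapunov _
  · simp only [h2c, hcomplex, cPosDef_iff_posDef, commutator_eq_iff_lyapunov hST hJ]
    exact exists_complex_posDef_lyapunov_iff_real _
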